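/- arXiv:1410.8585 — 2 statements merged into one kernel-verified Lean document; each statement's English description precedes it below -/
import Mathlib

section
/- Let n be an even positive integer, let SU(n) be the special unitary group of n × n complex matrices, and let μ be the Haar probability measure on SU(n). Then the number of even Latin squares of size n differs from the number of odd Latin squares of size n (the Alon–Tarsi property for n) if and only if ∫_{g ∈ SU(n)} (∏_{1 ≤ i,j ≤ n} g_{ij}) dμ(g) ≠ 0, where g_{ij} are the matrix entries of g. -/
open scoped Classical

namespace AlonTarsi

/-- `L` is a Latin square: each row and each column is a bijection of `Fin n`. -/
def IsLatin {n : ℕ} (L : Fin n → Fin n → Fin n) : Prop :=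
  (∀ k, Function.Bijective fun i => L k i) ∧ (∀ i, Function.Bijective fun k => L k i)

/-- The sign of a function `Fin n → Fin n`: the sign of the corresponding permutation
if it is bijective, and `1` otherwise. -/
noncomputable def signFun {n : ℕ} (f : Fin n → Fin n) : ℤ :=
  if h : Function.Bijective f then (Equiv.Perm.sign (Equiv.ofBijective f h) : ℤ) else 1

noncomputable def rowSign {n : ℕ} (L : Fin n → Fin n → Fin n) : ℤ :=
  ∏ k, signFun fun i => L k i

noncomputable def colSign {n : ℕ} (L : Fin n → Fin n → Fin n) : ℤ :=
  ∏ i, signFun fun k => L k i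

noncomputable def sign {n : ℕ} (L : Fin n → Fin n → Fin n) : ℤ :=
  rowSign L * colSign L

noncomputable def evenCard (n : ℕ) : ℕ :=
  (Finset.univ.filter fun L : Fin n → Fin n → Fin n => IsLatin L ∧ sign L = 1).card

noncomputable def oddCard (n : ℕ) : ℕ :=
  (Finset.univ.filter fun L : Fin n → Fin n → Fin n => IsLatin L ∧ sign L = -1).card

noncomputable def colEvenCard (n : ℕ) : ℕ :=
  (Finset.univ.filter fun L : Fin n → Fin n → Fin n => IsLatin L ∧ colSign L = 1).card

noncomputable def colOddCard (n : ℕ) : ℕ :=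
  (Finset.univ.filter fun L : Fin n → Fin n → Fin n => IsLatin L ∧ colSign L = -1).card

noncomputable instance (n : ℕ) : MeasurableSpace (Matrix.specialUnitaryGroup (Fin n) ℂ) :=
  borel _

instance (n : ℕ) : BorelSpace (Matrix.specialUnitaryGroup (Fin n) ℂ) := ⟨rfl⟩

/-! ### Signs of Latin squares -/

section Signs

open Finset Equiv

variable {n : ℕ}

lemma signFun_coe (σ : Perm (Fin n)) : signFun σ = Perm.sign σ := by
  rw [signFun, dif_pos σ.bijective]
  congr
  ext
  simp

lemma signFun_eq_one_or (f : Fin n → Fin n) : signFun f = 1 ∨ signFun f = -1 := by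
  unfold signFun
  split_ifs
  · rcases Int.units_eq_one_or (Perm.sign (Equiv.ofBijective f ‹_›)) with h | h <;> simp [h]
  · exact Or.inl rfl

lemma isUnit_signFun (f : Fin n → Fin n) : IsUnit (signFun f) :=
  Int.isUnit_iff.2 (signFun_eq_one_or f)

lemma sign_eq_one_or (L : Fin n → Fin n → Fin n) : sign L = 1 ∨ sign L = -1 := by
  have h (M : Fin n → Fin n → Fin n) : IsUnit (∏ k, signFun (M k)) :=
    prod_induction _ IsUnit (fun _ _ => IsUnit.mul) isUnit_one fun k _ => isUnit_signFun _
  exact Int.isUnit_iff.1 ((h L).mul (h fun i k => L k i))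

lemma evenCard_sub_oddCard :
    (evenCard n : ℤ) - oddCard n = ∑ L : Fin n → Fin n → Fin n, if IsLatin L then sign L else 0 := by
  simp only [evenCard, oddCard, card_filter, Nat.cast_sum, ← sum_sub_distrib]
  refine sum_congr rfl fun L _ => ?_
  by_cases hL : IsLatin L <;> rcases sign_eq_one_or L with h | h <;> simp [hL, h]

/-- A family of permutations is the family of rows of a Latin square. -/
def IsLatinRows (f : Fin n → Perm (Fin n)) : Prop :=
  ∀ i, Function.Bijective fun k => f k i

lemma isLatin_coe_iff (f : Fin n → Perm (Fin n)) :
    IsLatin (fun k => ⇑(f k)) ↔ IsLatinRows f :=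
  ⟨fun h => h.2, fun h => ⟨fun k => (f k).bijective, h⟩⟩

lemma sum_isLatin (φ : (Fin n → Fin n → Fin n) → ℤ) :
    (∑ L, if IsLatin L then φ L else 0) =
      ∑ f : Fin n → Perm (Fin n), if IsLatinRows f then φ (fun k => ⇑(f k)) else 0 := by
  symm
  refine Fintype.sum_of_injective (fun (f : Fin n → Perm (Fin n)) k => ⇑(f k)) ?_ _ _ ?_ ?_
  · intro f g h
    ext k : 1
    exact DFunLike.coe_injective (congrFun h k)
  · intro L hL
    rw [if_neg]
    intro h
    exact hL ⟨fun k => Equiv.ofBijective _ (h.1 k), rfl⟩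
  · intro f
    simp only [isLatin_coe_iff]

lemma IsLatinRows.inv {f : Fin n → Perm (Fin n)} (h : IsLatinRows f) : IsLatinRows f⁻¹ := by
  intro s
  refine Finite.injective_iff_bijective.1 fun k k' hk => ?_
  refine (h ((f k)⁻¹ s)).1 ?_
  have hk : (f k)⁻¹ s = (f k')⁻¹ s := hk
  change f k ((f k)⁻¹ s) = f k' ((f k)⁻¹ s)
  conv_rhs => rw [hk]
  simp

lemma isLatinRows_inv_iff {f : Fin n → Perm (Fin n)} : IsLatinRows f⁻¹ ↔ IsLatinRows f :=
  ⟨fun h => by simpa using h.inv, IsLatinRows.inv⟩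

lemma rowSign_coe (f : Fin n → Perm (Fin n)) :
    rowSign (fun k => ⇑(f k)) = ∏ k, (Perm.sign (f k) : ℤ) :=
  prod_congr rfl fun k _ => signFun_coe (f k)

/-- The row, column and symbol signs of a Latin square have a constant product. -/
lemma sign_coe_eq {f : Fin n → Perm (Fin n)} (h : IsLatinRows f) :
    sign (fun k => ⇑(f k)) =
      (Perm.sign (Equiv.prodComm (Fin n) (Fin n)) : ℤ) * colSign (fun k => ⇑((f⁻¹) k)) := by
  let c i : Perm (Fin n) := Equiv.ofBijective _ (h i)
  let d s : Perm (Fin n) := Equiv.ofBijective _ (h.inv s)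
  have hc : colSign (fun k => ⇑(f k)) = ((∏ i, Perm.sign (c i) : ℤˣ) : ℤ) := by
    rw [Units.coe_prod]
    exact prod_congr rfl fun i _ => signFun_coe (c i)
  have hd : colSign (fun k => ⇑((f⁻¹) k)) = ((∏ i, Perm.sign (d i) : ℤˣ) : ℤ) := by
    rw [Units.coe_prod]
    exact prod_congr rfl fun i _ => signFun_coe (d i)
  have hr : rowSign (fun k => ⇑(f k)) = ((∏ i, Perm.sign (f i) : ℤˣ) : ℤ) := by
    rw [Units.coe_prod, rowSign_coe]
  have key : (prodCongrLeft d : Perm (Fin n × Fin n)) * prodCongrRight f =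
      (Equiv.prodComm (Fin n) (Fin n) : Perm (Fin n × Fin n)) * prodCongrLeft c := by
    ext ⟨k, i⟩ : 1
    simp [c, d]
  have key' := congrArg Perm.sign key
  rw [Perm.sign_mul, Perm.sign_mul, Perm.sign_prodCongrLeft, Perm.sign_prodCongrRight,
    Perm.sign_prodCongrLeft] at key'
  rw [sign, hc, hd, hr, ← Units.val_mul, ← Units.val_mul, Units.val_inj]
  set ε : ℤˣ := Perm.sign (Equiv.prodComm (Fin n) (Fin n))
  have hcol : ∏ i, Perm.sign (c i) = ε * ((∏ i, Perm.sign (d i)) * ∏ i, Perm.sign (f i)) := by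
    rw [key', ← mul_assoc, Int.units_mul_self, one_mul]
  rw [hcol, mul_left_comm, mul_left_comm (∏ i, Perm.sign (f i)), Int.units_mul_self, mul_one]

lemma sum_colSign_eq_sum_rowSign :
    (∑ L : Fin n → Fin n → Fin n, if IsLatin L then colSign L else 0) =
      ∑ L : Fin n → Fin n → Fin n, if IsLatin L then rowSign L else 0 := by
  refine Fintype.sum_equiv (Equiv.piComm _) _ _ fun L => ?_
  have : IsLatin (Equiv.piComm (fun _ _ => Fin n) L) ↔ IsLatin L := and_comm
  simp only [this]
  rfl

/-- Up to a global sign, even minus odd Latin squares is the sum of the row signs. -/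
lemma evenCard_sub_oddCard_eq_rows :
    (evenCard n : ℤ) - oddCard n = (Perm.sign (Equiv.prodComm (Fin n) (Fin n)) : ℤ) *
      ∑ f : Fin n → Perm (Fin n), if IsLatinRows f then ∏ k, (Perm.sign (f k) : ℤ) else 0 := by
  have hrow : (∑ f : Fin n → Perm (Fin n),
      if IsLatinRows f then ∏ k, (Perm.sign (f k) : ℤ) else 0) =
      ∑ f : Fin n → Perm (Fin n),
        if IsLatinRows f then colSign (fun k => ⇑((f⁻¹) k)) else 0 := by
    calc _ = ∑ f : Fin n → Perm (Fin n), if IsLatinRows f then rowSign (fun k => ⇑(f k)) else 0 := by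
          simp only [rowSign_coe]
      _ = ∑ f : Fin n → Perm (Fin n), if IsLatinRows f then colSign (fun k => ⇑(f k)) else 0 := by
          rw [← sum_isLatin, ← sum_isLatin, sum_colSign_eq_sum_rowSign]
      _ = _ := by
          refine Fintype.sum_equiv (Equiv.inv _) _ _ fun f => ?_
          simp [isLatinRows_inv_iff]
  rw [evenCard_sub_oddCard, sum_isLatin, hrow, mul_sum]
  refine sum_congr rfl fun f _ => ?_
  split_ifs with h
  · exact sign_coe_eq h
  · simp

lemma evenCard_ne_oddCard_iff :
    evenCard n ≠ oddCard n ↔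
      (∑ f : Fin n → Perm (Fin n), if IsLatinRows f then ∏ k, (Perm.sign (f k) : ℤ) else 0) ≠ 0 := by
  rw [← Nat.cast_injective (R := ℤ) |>.ne_iff, ← sub_ne_zero,
    evenCard_sub_oddCard_eq_rows, mul_ne_zero_iff]
  exact and_iff_right (Units.ne_zero _)

end Signs

/-! ### The multilinear coefficient of a power of the determinant -/

section Coefficient

open Finset Equiv MvPolynomial Matrix

variable {n : ℕ} {R : Type*} [CommRing R]

/-- The exponent of the monomial `∏ i j, X (i, j)`. -/
noncomputable def onesExponent (n : ℕ) : Fin n × Fin n →₀ ℕ :=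
  Finsupp.equivFunOnFinite.symm fun _ => 1

lemma sum_single_eq_onesExponent_iff (f : Fin n → Perm (Fin n)) :
    ∑ k, ∑ i, Finsupp.single (f k i, i) 1 = onesExponent n ↔ IsLatinRows f := by
  have key (j i : Fin n) : (∑ k, ∑ i', Finsupp.single (f k i', i') 1 : Fin n × Fin n →₀ ℕ) (j, i) =
      #{k | f k i = j} := by
    simp only [Finsupp.coe_finsetSum, Finset.sum_apply, card_filter]
    refine sum_congr rfl fun k _ => ?_
    rw [Finset.sum_eq_single i]
    · simp [Finsupp.single_apply]
    · intro i' _ hi'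
      simp [hi']
    · simp
  rw [Finsupp.ext_iff, Prod.forall, IsLatinRows, forall_comm]
  refine forall_congr' fun i => ?_
  simp only [key, Function.bijective_iff_existsUnique]
  refine forall_congr' fun j => ?_
  simp [onesExponent, card_eq_one, ExistsUnique, Finset.eq_singleton_iff_unique_mem]

lemma coeff_det_pow :
    coeff (onesExponent n) ((mvPolynomialX (Fin n) (Fin n) R).det ^ n) =
      ((∑ f : Fin n → Perm (Fin n),
        if IsLatinRows f then ∏ k, (Perm.sign (f k) : ℤ) else 0 : ℤ) : R) := by
  have hdet : (mvPolynomialX (Fin n) (Fin n) R).det =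
      ∑ σ : Perm (Fin n), monomial (∑ i, Finsupp.single (σ i, i) 1) ((Perm.sign σ : ℤ) : R) := by
    rw [det_apply']
    refine sum_congr rfl fun σ _ => ?_
    rw [← mul_one (((Perm.sign σ : ℤ)) : R), ← C_mul_monomial, monomial_sum_one]
    simp [mvPolynomialX_apply, X]
  have hpow : (mvPolynomialX (Fin n) (Fin n) R).det ^ n =
      ∏ _k : Fin n, (mvPolynomialX (Fin n) (Fin n) R).det := by simp
  rw [hpow, hdet, Fintype.prod_sum, coeff_sum, Int.cast_sum]
  refine sum_congr rfl fun f _ => ?_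
  rw [← monomial_sum_prod, coeff_monomial]
  simp only [sum_single_eq_onesExponent_iff]
  split_ifs <;> simp

end Coefficient

/-! ### The apolar pairing on polynomials -/

section Apolar

open Finset MvPolynomial
open scoped Nat

variable {σ R S : Type*} [CommRing R] [CommRing S]

/-- The apolar pairing `⟨f, h⟩ = (f(∂) h)(0)`, for which distinct monomials are orthogonal. -/
noncomputable def apolar : MvPolynomial σ R →ₗ[R] MvPolynomial σ R →ₗ[R] R :=
  (basisMonomials σ R).constr R fun m => (m.prod fun _ k => (k ! : R)) • lcoeff R m

lemma apolar_monomial (m : σ →₀ ℕ) (c : R) (h : MvPolynomial σ R) :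
    apolar (monomial m c) h = c * (m.prod fun _ k => (k ! : R)) * coeff m h := by
  have h1 : apolar (monomial m (1 : R)) = (m.prod fun _ k => (k ! : R)) • lcoeff R m := by
    have hb : monomial m (1 : R) = basisMonomials σ R m := by simp
    rw [hb, apolar, Module.Basis.constr_basis]
  rw [← mul_one c, ← smul_eq_mul, ← smul_monomial, map_smul, h1]
  simp [mul_assoc]

lemma apolar_mul_X (f h : MvPolynomial σ R) (s : σ) :
    apolar (f * X s) h = apolar f (pderiv s h) := by
  induction f using MvPolynomial.induction_on' with
  | add p q hp hq => simp [add_mul, hp, hq]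
  | monomial m c =>
    have hprod : ((m + Finsupp.single s 1).prod fun _ k => (k ! : R)) =
        (m.prod fun _ k => (k ! : R)) * (m s + 1) := by
      have hm : (m + Finsupp.single s 1).prod (fun _ k => (k ! : R)) =
          (((m + Finsupp.single s 1 : σ →₀ ℕ) s) ! : R) * (m.erase s).prod fun _ k => (k ! : R) := by
        rw [← Finsupp.mul_prod_erase' (m + Finsupp.single s 1) s _ (by simp)]
        simp [Finsupp.erase_add]
      rw [hm, ← Finsupp.mul_prod_erase' m s _ (by simp)]
      simp [Nat.factorial_succ]
      ring
    rw [X, monomial_mul, mul_one, apolar_monomial, apolar_monomial, hprod, coeff_pderiv]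
    ring

lemma apolar_map (ψ : R →+* S) (f h : MvPolynomial σ R) :
    apolar (map ψ f) (map ψ h) = ψ (apolar f h) := by
  induction f using MvPolynomial.induction_on' with
  | add p q hp hq => simp [hp, hq]
  | monomial m c => simp [apolar_monomial, coeff_map, map_finsuppProd]

lemma apolar_self_pos {f : MvPolynomial σ ℝ} (hf : f ≠ 0) : 0 < apolar f f := by
  have h : apolar f f =
      ∑ m ∈ f.support, coeff m f ^ 2 * (m.prod fun _ k => (k ! : ℝ)) := by
    conv_lhs => enter [1]; rw [f.as_sum]
    rw [map_sum, LinearMap.sum_apply]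
    refine sum_congr rfl fun m _ => ?_
    rw [apolar_monomial]
    ring
  rw [h]
  refine sum_pos (fun m hm => ?_) (support_nonempty.2 hf)
  have h1 : coeff m f ≠ 0 := mem_support_iff.1 hm
  have h2 : 0 < m.prod fun _ k => (k ! : ℝ) :=
    prod_pos fun i _ => Nat.cast_pos.2 (Nat.factorial_pos _)
  positivity

variable [Fintype σ]

/-- The linear change of variables with matrix `A`. -/
noncomputable def linSubst (A : Matrix σ σ R) : MvPolynomial σ R →ₐ[R] MvPolynomial σ R :=
  aeval fun s => ∑ t, A s t • X t

lemma linSubst_X (A : Matrix σ σ R) (s : σ) :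
    linSubst A (X s) = ∑ t, A s t • (X t : MvPolynomial σ R) := by
  simp [linSubst]

lemma pderiv_linSubst (A : Matrix σ σ R) (s : σ) (h : MvPolynomial σ R) :
    pderiv s (linSubst A h) = ∑ t, A t s • linSubst A (pderiv t h) := by
  have hX (t : σ) : pderiv s (linSubst A (X t)) = C (A t s) := by
    simp [linSubst_X, pderiv_X, Pi.single_apply, smul_eq_C_mul]
  induction h using MvPolynomial.induction_on with
  | C a => simp [linSubst]
  | add p q hp hq => simp [hp, hq, sum_add_distrib]
  | mul_X p t hp =>
    simp only [map_mul, Derivation.leibniz, hX, hp, smul_eq_mul, map_add, smul_add,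
      sum_add_distrib, pderiv_X, Pi.single_apply, apply_ite (linSubst A), map_one, map_zero]
    simp [mul_sum, smul_eq_C_mul, mul_comm, mul_left_comm]

lemma apolar_linSubst (A : Matrix σ σ R) (f h : MvPolynomial σ R) :
    apolar (linSubst A f) h = apolar f (linSubst A.transpose h) := by
  induction f using MvPolynomial.induction_on generalizing h with
  | C a =>
    have h0 : coeff 0 (linSubst A.transpose h) = coeff 0 h := by
      simp only [← constantCoeff_eq]
      induction h using MvPolynomial.induction_on with
      | C a => simp [linSubst]
      | add p q hp hq => simp [hp, hq]
      | mul_X p t hp => simp [linSubst_X]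
    rw [linSubst, aeval_C, algebraMap_eq, C_apply, apolar_monomial, apolar_monomial, h0]
  | add p q hp hq => simp [hp, hq]
  | mul_X p t hp =>
    rw [apolar_mul_X, pderiv_linSubst, map_mul]
    simp [linSubst_X, mul_sum, apolar_mul_X, hp]

lemma eval_linSubst (A : Matrix σ σ R) (x : σ → R) (f : MvPolynomial σ R) :
    eval x (linSubst A f) = eval (A.mulVec x) f := by
  induction f using MvPolynomial.induction_on with
  | C a => simp [linSubst]
  | add p q hp hq => simp [hp, hq]
  | mul_X p t hp => simp [hp, linSubst_X, Matrix.mulVec, dotProduct, smul_eq_C_mul]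

end Apolar

/-! ### Polynomials on matrices that are equivariant under the unitary group -/

section Unitary

open Finset MvPolynomial Matrix
open scoped ComplexOrder

variable {ι : Type*} [Fintype ι] [DecidableEq ι]

/-- The value at a matrix of a polynomial in its entries. -/
noncomputable def evalMatrix {R : Type*} [CommRing R] (F : MvPolynomial (ι × ι) R)
    (M : Matrix ι ι R) : R :=
  eval (fun p => M p.1 p.2) F

lemma evalMatrix_det {R : Type*} [CommRing R] (M : Matrix ι ι R) :
    evalMatrix (mvPolynomialX ι ι R).det M = M.det :=
  eval_det_mvPolynomialX ι R _

lemma evalMatrix_aeval {R : Type*} [CommRing R] (F : MvPolynomial (ι × ι) R)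
    (N : Matrix ι ι (MvPolynomial (ι × ι) R)) (M : Matrix ι ι R) :
    evalMatrix (aeval (fun p : ι × ι => N p.1 p.2) F) M =
      evalMatrix F ((eval fun p : ι × ι => M p.1 p.2).mapMatrix N) := by
  simp only [evalMatrix]
  induction F using MvPolynomial.induction_on with
  | C a => rw [aeval_C, algebraMap_eq, eval_C, eval_C]
  | add p q hp hq => rw [map_add, map_add, map_add, hp, hq]
  | mul_X p t hp => rw [map_mul, map_mul, map_mul, hp, aeval_X, eval_X]; rfl

/-- Skew-Hermitian matrices are Zariski dense. -/
lemma eq_zero_of_evalMatrix_skewHermitian {Q : MvPolynomial (ι × ι) ℂ}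
    (h : ∀ A : Matrix ι ι ℂ, Aᴴ = -A → evalMatrix Q A = 0) : Q = 0 := by
  let α : ℂ := 1 + Complex.I
  let β : ℂ := Complex.I - 1
  let N : Matrix ι ι (MvPolynomial (ι × ι) ℂ) :=
    α • mvPolynomialX ι ι ℂ + β • (mvPolynomialX ι ι ℂ)ᵀ
  have heval (M : Matrix ι ι ℂ) :
      evalMatrix (aeval (fun p : ι × ι => N p.1 p.2) Q) M = evalMatrix Q (α • M + β • Mᵀ) := by
    rw [evalMatrix_aeval]
    congr 1
    ext i j
    simp [N, mvPolynomialX_apply, smul_eq_C_mul]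
  have hzero : aeval (fun p : ι × ι => N p.1 p.2) Q = 0 := by
    refine funext_set (fun _ => Set.range ((↑) : ℝ → ℂ))
      (fun _ => Set.infinite_range_of_injective Complex.ofReal_injective) fun x hx => ?_
    choose r hr using fun p => hx p (Set.mem_univ p)
    have hM := heval (Matrix.of fun i j => x (i, j))
    rw [h] at hM
    · simpa [evalMatrix] using hM
    · ext i j
      simp only [conjTranspose_apply, Matrix.add_apply, Matrix.smul_apply, transpose_apply, of_apply,
        ← hr, Matrix.neg_apply, smul_eq_mul, α, β, star_add, star_mul', star_sub, star_one,
        Complex.star_def, Complex.conj_I, Complex.conj_ofReal]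
      ring
  refine MvPolynomial.funext fun x => ?_
  let A : Matrix ι ι ℂ := Matrix.of fun i j => x (i, j)
  have hA := heval ((4 * Complex.I)⁻¹ • (α • A - β • Aᵀ))
  have hA' : α • ((4 * Complex.I)⁻¹ • (α • A - β • Aᵀ)) +
      β • ((4 * Complex.I)⁻¹ • (α • A - β • Aᵀ))ᵀ = A := by
    ext i j
    simp only [Matrix.add_apply, Matrix.smul_apply, transpose_apply, Matrix.sub_apply, smul_eq_mul,
      α, β]
    field_simp
    ring
  rw [hzero, hA'] at hA
  simpa [evalMatrix, A] using hA.symm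

lemma isUnit_one_sub_of_skewHermitian {A : Matrix ι ι ℂ} (hA : Aᴴ = -A) : IsUnit (1 - A) := by
  have h : (1 + A) * (1 - A) = 1 + Aᴴ * A := by
    rw [hA]
    noncomm_ring
  refine isUnit_of_mul_isUnit_right (x := 1 + A) ?_
  rw [h]
  exact (PosDef.one.add_posSemidef (posSemidef_conjTranspose_mul_self A)).isUnit

/-- The Cayley transform of a skew-Hermitian matrix is unitary. -/
lemma cayley_mem_unitaryGroup {A : Matrix ι ι ℂ} (hA : Aᴴ = -A) :
    (1 + A) * (1 - A)⁻¹ ∈ unitaryGroup ι ℂ := by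
  have h1 : IsUnit (1 - A) := isUnit_one_sub_of_skewHermitian hA
  have h2 : IsUnit (1 + A) := by
    simpa using isUnit_one_sub_of_skewHermitian (A := -A) (by simp [hA])
  rw [mem_unitaryGroup_iff', star_eq_conjTranspose, conjTranspose_mul, conjTranspose_nonsing_inv,
    conjTranspose_sub, conjTranspose_add, hA, conjTranspose_one, sub_neg_eq_add, ← sub_eq_add_neg]
  rw [isUnit_iff_isUnit_det] at h1 h2
  have hcomm : (1 - A) * (1 + A) = (1 + A) * (1 - A) := by noncomm_ring
  rw [mul_assoc, ← mul_assoc (1 - A), hcomm, mul_assoc (1 + A), mul_nonsing_inv _ h1, mul_one,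
    nonsing_inv_mul _ h2]

/-- A polynomial on matrices that is semi-invariant under left multiplication by unitary
matrices is a multiple of a power of the determinant. -/
lemma eq_C_mul_det_pow {F : MvPolynomial (ι × ι) ℂ} {d : ℕ}
    (h : ∀ U ∈ unitaryGroup ι ℂ, ∀ M, evalMatrix F (U * M) = U.det ^ d * evalMatrix F M) :
    F = C (evalMatrix F 1) * (mvPolynomialX ι ι ℂ).det ^ d := by
  have hcayley (W A : Matrix ι ι ℂ) : evalMatrix F ((1 + A) * W) * (1 - A).det ^ d =
      (1 + A).det ^ d * evalMatrix F ((1 - A) * W) := by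
    let Z : Matrix ι ι (MvPolynomial (ι × ι) ℂ) := mvPolynomialX ι ι ℂ
    let N₁ : Matrix ι ι (MvPolynomial (ι × ι) ℂ) := (1 + Z) * W.map C
    let N₂ : Matrix ι ι (MvPolynomial (ι × ι) ℂ) := (1 - Z) * W.map C
    let Q : MvPolynomial (ι × ι) ℂ :=
      aeval (fun p : ι × ι => N₁ p.1 p.2) F * (1 - Z).det ^ d -
        (1 + Z).det ^ d * aeval (fun p : ι × ι => N₂ p.1 p.2) F
    have hQ (B : Matrix ι ι ℂ) : evalMatrix Q B =
        evalMatrix F ((1 + B) * W) * (1 - B).det ^ d -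
          (1 + B).det ^ d * evalMatrix F ((1 - B) * W) := by
      have hZ : (eval fun p : ι × ι => B p.1 p.2).mapMatrix Z = B := mvPolynomialX_mapMatrix_eval B
      have hW : (eval fun p : ι × ι => B p.1 p.2).mapMatrix (W.map C) = W := by
        ext i j
        simp
      have h1 := evalMatrix_aeval F N₁ B
      have h2 := evalMatrix_aeval F N₂ B
      rw [map_mul, map_add, map_one, hZ, hW] at h1
      rw [map_mul, map_sub, map_one, hZ, hW] at h2
      rw [← h1, ← h2]
      simp only [Q, evalMatrix, map_sub, map_mul, map_pow, RingHom.map_det, map_add, map_one, hZ]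
    have hQ0 : Q = 0 := eq_zero_of_evalMatrix_skewHermitian fun B hB => by
      have hdet : IsUnit (1 - B).det :=
        (isUnit_iff_isUnit_det _).1 (isUnit_one_sub_of_skewHermitian hB)
      have hU := h _ (cayley_mem_unitaryGroup hB) ((1 - B) * W)
      rw [mul_assoc, nonsing_inv_mul_cancel_left _ _ hdet] at hU
      have hdet' : ((1 + B) * (1 - B)⁻¹).det * (1 - B).det = (1 + B).det := by
        rw [← det_mul, nonsing_inv_mul_cancel_right _ _ hdet]
      rw [hQ, hU, ← hdet', mul_pow]
      ring
    rw [← sub_eq_zero, ← hQ, hQ0]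
    simp [evalMatrix]
  have hpoint (M : Matrix ι ι ℂ) (hM : IsUnit (1 + M).det) :
      evalMatrix F M = evalMatrix F 1 * M.det ^ d := by
    set W : Matrix ι ι ℂ := (2 : ℂ)⁻¹ • (1 + M)
    have hW : IsUnit W.det := by
      rw [det_smul]
      exact (IsUnit.mk0 _ (pow_ne_zero _ (by norm_num))).mul hM
    set A : Matrix ι ι ℂ := (M - W) * W⁻¹
    have hAW : A * W = M - W := nonsing_inv_mul_cancel_right _ _ hW
    have h1 : (1 + A) * W = M := by rw [add_mul, hAW, one_mul]; abel
    have h2 : (1 - A) * W = 1 := by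
      rw [sub_mul, hAW, one_mul]
      ext i j
      simp [W]
      ring
    have hd1 := congrArg det h1
    have hd2 := congrArg det h2
    rw [det_mul] at hd1 hd2
    have hc := hcayley W A
    rw [h1, h2] at hc
    calc evalMatrix F M = evalMatrix F M * (1 - A).det ^ d * W.det ^ d := by
          rw [mul_assoc, ← mul_pow, hd2, det_one, one_pow, mul_one]
      _ = evalMatrix F 1 * M.det ^ d := by
          rw [hc, ← hd1, mul_pow]
          ring
  have hprod : (F - C (evalMatrix F 1) * (mvPolynomialX ι ι ℂ).det ^ d) *
      (1 + mvPolynomialX ι ι ℂ).det = 0 := by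
    refine MvPolynomial.funext fun x => ?_
    let M : Matrix ι ι ℂ := Matrix.of fun i j => x (i, j)
    have hZ : (eval x).mapMatrix (mvPolynomialX ι ι ℂ) = M := mvPolynomialX_mapMatrix_eval M
    have hF : eval x F = evalMatrix F M := rfl
    rw [map_mul, map_sub, map_mul, map_pow, RingHom.map_det, RingHom.map_det, map_add, map_one,
      hZ, eval_C, hF, map_zero]
    by_cases hM : (1 + M).det = 0
    · rw [hM, mul_zero]
    · rw [hpoint M (IsUnit.mk0 _ hM), sub_self, zero_mul]
  refine sub_eq_zero.1 ((mul_eq_zero.1 hprod).resolve_right fun h0 => ?_)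
  have := congrArg (fun p => evalMatrix p 0) h0
  have hZ : (eval fun p : ι × ι => (0 : Matrix ι ι ℂ) p.1 p.2).mapMatrix (mvPolynomialX ι ι ℂ) = 0 :=
    mvPolynomialX_mapMatrix_eval 0
  simp only [evalMatrix, RingHom.map_det, map_add, map_one, hZ, add_zero, det_one, map_zero] at this
  exact one_ne_zero this

end Unitary

/-! ### Averaging the product of the entries over the special unitary group -/

section Averaging

open Finset MvPolynomial Matrix MeasureTheory
open scoped Kronecker

instance {ι : Type*} [Fintype ι] [DecidableEq ι] :
    CompactSpace (specialUnitaryGroup ι ℂ) := by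
  refine isCompact_iff_compactSpace.1 ?_
  let K : Set (Matrix ι ι ℂ) := Set.univ.pi fun _ => Set.univ.pi fun _ => Metric.closedBall 0 1
  have hK : IsCompact K :=
    isCompact_univ_pi fun _ => isCompact_univ_pi fun _ => isCompact_closedBall 0 1
  refine hK.of_isClosed_subset ?_ ?_
  · have : (specialUnitaryGroup ι ℂ : Set (Matrix ι ι ℂ)) =
        {A | A * star A = 1} ∩ {A | A.det = 1} := by
      ext A
      simp [mem_specialUnitaryGroup_iff, mem_unitaryGroup_iff]
    rw [this]
    exact (isClosed_eq (by fun_prop) continuous_const).inter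
      (isClosed_eq (by fun_prop) continuous_const)
  · intro A hA i _ j _
    simpa using entry_norm_bound_of_unitary (specialUnitaryGroup_le_unitaryGroup hA) i j

/-- Linear functionals commute with averages of polynomials whose coefficients depend
polynomially on a continuous parameter. -/
lemma exists_average {G σ τ : Type*} [TopologicalSpace G] [CompactSpace G] [MeasurableSpace G]
    [BorelSpace G] (μ : Measure G) [IsFiniteMeasure μ] {γ : G → τ → ℂ} (hγ : Continuous γ)
    (Φ : MvPolynomial σ (MvPolynomial τ ℂ)) :
    ∃ F : MvPolynomial σ ℂ, ∀ ℓ : MvPolynomial σ ℂ →ₗ[ℂ] ℂ,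
      ℓ F = ∫ g, ℓ (map (eval (γ g)) Φ) ∂μ := by
  refine ⟨∑ m ∈ Φ.support, monomial m (∫ g, eval (γ g) (coeff m Φ) ∂μ), fun ℓ => ?_⟩
  have hℓ (m : σ →₀ ℕ) (c : ℂ) : ℓ (monomial m c) = c * ℓ (monomial m 1) := by
    rw [← smul_eq_mul, ← map_smul, smul_monomial, smul_eq_mul, mul_one]
  have hmap (g : G) : ℓ (map (eval (γ g)) Φ) =
      ∑ m ∈ Φ.support, eval (γ g) (coeff m Φ) * ℓ (monomial m 1) := by
    conv_lhs => rw [Φ.as_sum, map_sum, map_sum]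
    exact sum_congr rfl fun m _ => by rw [map_monomial, hℓ]
  have hint (m : σ →₀ ℕ) : Integrable (fun g => eval (γ g) (coeff m Φ)) μ := by
    have hc : Continuous fun g => eval (γ g) (coeff m Φ) :=
      (MvPolynomial.continuous_eval _).comp hγ
    exact hc.integrable_of_hasCompactSupport (HasCompactSupport.of_compactSpace _)
  simp_rw [hmap]
  rw [integral_finsetSum _ fun m _ => (hint m).mul_const _, map_sum]
  exact sum_congr rfl fun m _ => by rw [hℓ, integral_mul_const]

variable {n : ℕ}

/-- The product of all entries of a matrix, as a polynomial. -/
noncomputable def prodEntries (n : ℕ) : MvPolynomial (Fin n × Fin n) ℂ :=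
  ∏ i, ∏ j, X (i, j)

lemma prodEntries_eq_monomial : prodEntries n = monomial (onesExponent n) 1 := by
  rw [monomial_eq, Finsupp.prod_fintype _ _ (by simp), Fintype.prod_prod_type]
  simp [prodEntries, onesExponent]

lemma evalMatrix_prodEntries (M : Matrix (Fin n) (Fin n) ℂ) :
    evalMatrix (prodEntries n) M = ∏ i, ∏ j, M i j := by
  simp [evalMatrix, prodEntries]

lemma evalMatrix_smul_prodEntries (ζ : ℂ) (M : Matrix (Fin n) (Fin n) ℂ) :
    evalMatrix (prodEntries n) (ζ • M) = (ζ ^ n) ^ n * evalMatrix (prodEntries n) M := by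
  simp [evalMatrix_prodEntries, prod_mul_distrib]

lemma evalMatrix_linSubst_kronecker (A M : Matrix (Fin n) (Fin n) ℂ)
    (f : MvPolynomial (Fin n × Fin n) ℂ) :
    evalMatrix (linSubst (A ⊗ₖ (1 : Matrix (Fin n) (Fin n) ℂ)) f) M = evalMatrix f (A * M) := by
  rw [evalMatrix, evalMatrix, eval_linSubst]
  congr
  ext ⟨i, j⟩
  simp [mulVec, dotProduct, Fintype.sum_prod_type, one_apply, mul_apply]

lemma linSubst_kronecker_det (A : Matrix (Fin n) (Fin n) ℂ) :
    linSubst (A ⊗ₖ (1 : Matrix (Fin n) (Fin n) ℂ)) (mvPolynomialX (Fin n) (Fin n) ℂ).det =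
      C A.det * (mvPolynomialX (Fin n) (Fin n) ℂ).det := by
  refine MvPolynomial.funext fun x => ?_
  have h := evalMatrix_linSubst_kronecker A (Matrix.of fun i j => x (i, j))
    (mvPolynomialX (Fin n) (Fin n) ℂ).det
  rw [evalMatrix_det, det_mul] at h
  rw [map_mul, eval_C, eval_det_mvPolynomialX, ← h]
  rfl

/-- The product of the entries of `Y * X`, for generic matrices `Y` and `X`. -/
noncomputable def genericProdEntries (n : ℕ) :
    MvPolynomial (Fin n × Fin n) (MvPolynomial (Fin n × Fin n) ℂ) :=
  ∏ i, ∏ j, ∑ k, C (X (i, k)) * X (k, j)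

lemma map_genericProdEntries (A : Matrix (Fin n) (Fin n) ℂ) :
    map (eval fun p : Fin n × Fin n => A p.1 p.2) (genericProdEntries n) =
      linSubst (A ⊗ₖ (1 : Matrix (Fin n) (Fin n) ℂ)) (prodEntries n) := by
  simp [genericProdEntries, prodEntries, map_prod, linSubst_X, Fintype.sum_prod_type, one_apply,
    smul_eq_C_mul]

lemma apolar_prodEntries_linSubst {A : Matrix (Fin n) (Fin n) ℂ} (hA : A.det = 1) :
    apolar (linSubst (A ⊗ₖ (1 : Matrix (Fin n) (Fin n) ℂ)) (prodEntries n))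
      ((mvPolynomialX (Fin n) (Fin n) ℂ).det ^ n) =
    coeff (onesExponent n) ((mvPolynomialX (Fin n) (Fin n) ℂ).det ^ n) := by
  rw [apolar_linSubst, ← kroneckerMap_transpose, transpose_one, map_pow, linSubst_kronecker_det,
    det_transpose, hA, C_1, one_mul, prodEntries_eq_monomial, apolar_monomial,
    Finsupp.prod_fintype _ _ (by simp)]
  simp [onesExponent]

lemma apolar_det_pow_self_ne_zero :
    apolar ((mvPolynomialX (Fin n) (Fin n) ℂ).det ^ n)
      ((mvPolynomialX (Fin n) (Fin n) ℂ).det ^ n) ≠ 0 := by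
  have h : (mvPolynomialX (Fin n) (Fin n) ℂ).det ^ n =
      map Complex.ofRealHom ((mvPolynomialX (Fin n) (Fin n) ℝ).det ^ n) := by
    rw [map_pow, RingHom.map_det]
    congr 2
    ext i j : 2
    simp [mvPolynomialX_apply]
  rw [h, apolar_map]
  exact Complex.ofReal_ne_zero.2
    (apolar_self_pos (pow_ne_zero _ (det_mvPolynomialX_ne_zero _ _))).ne'

lemma exists_smul_mem_specialUnitaryGroup (hn : n ≠ 0) {U : Matrix (Fin n) (Fin n) ℂ}
    (hU : U ∈ unitaryGroup (Fin n) ℂ) :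
    ∃ ζ : ℂ, ∃ V ∈ specialUnitaryGroup (Fin n) ℂ, U = ζ • V ∧ U.det = ζ ^ n := by
  obtain ⟨ζ, hζ⟩ := IsAlgClosed.exists_pow_nat_eq U.det (Nat.pos_of_ne_zero hn)
  have hdet : ‖U.det‖ = 1 := by
    have := det_of_mem_unitary hU
    exact CStarRing.norm_of_mem_unitary this
  have hnorm : ‖ζ‖ = 1 := by
    rw [← hζ, norm_pow] at hdet
    exact (pow_eq_one_iff_of_nonneg (norm_nonneg _) hn).1 hdet
  have hζ0 : ζ ≠ 0 := by
    rintro rfl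
    simp at hnorm
  refine ⟨ζ, ζ⁻¹ • U, ?_, (smul_inv_smul₀ hζ0 U).symm, hζ.symm⟩
  rw [mem_specialUnitaryGroup_iff]
  constructor
  · rw [mem_unitaryGroup_iff, star_smul, smul_mul_smul_comm, mem_unitaryGroup_iff.1 hU,
      Complex.star_def, Complex.mul_conj, Complex.normSq_eq_norm_sq, norm_inv, hnorm]
    simp
  · rw [det_smul, ← hζ, Fintype.card_fin, inv_pow, inv_mul_cancel₀ (pow_ne_zero _ hζ0)]

lemma integral_prod_inv_entries (μ : Measure (specialUnitaryGroup (Fin n) ℂ)) :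
    ∫ g : specialUnitaryGroup (Fin n) ℂ,
        ∏ i, ∏ j, ((g⁻¹ : specialUnitaryGroup (Fin n) ℂ) : Matrix (Fin n) (Fin n) ℂ) i j ∂μ =
      starRingEnd ℂ (∫ g : specialUnitaryGroup (Fin n) ℂ,
        ∏ i, ∏ j, (g : Matrix (Fin n) (Fin n) ℂ) i j ∂μ) := by
  rw [← integral_conj]
  refine integral_congr_ae (.of_forall fun g => prod_comm.trans ?_)
  simp only [map_prod]
  rfl

/-- The multilinear coefficient of `det ^ n` is, up to a nonzero factor, the conjugate of the
integral of the product of the entries. -/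
lemma coeff_det_pow_eq_integral_mul (hn : n ≠ 0)
    (μ : Measure (specialUnitaryGroup (Fin n) ℂ)) [IsProbabilityMeasure μ] [μ.IsMulLeftInvariant] :
    coeff (onesExponent n) ((mvPolynomialX (Fin n) (Fin n) ℂ).det ^ n) =
      starRingEnd ℂ (∫ g : specialUnitaryGroup (Fin n) ℂ,
        ∏ i, ∏ j, (g : Matrix (Fin n) (Fin n) ℂ) i j ∂μ) *
      apolar ((mvPolynomialX (Fin n) (Fin n) ℂ).det ^ n)
        ((mvPolynomialX (Fin n) (Fin n) ℂ).det ^ n) := by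
  let inv (g : specialUnitaryGroup (Fin n) ℂ) : Matrix (Fin n) (Fin n) ℂ :=
    (g⁻¹ : specialUnitaryGroup (Fin n) ℂ)
  have hcont : Continuous inv :=
    (Continuous.star continuous_id).comp continuous_subtype_val
  obtain ⟨F, hF⟩ := exists_average μ (γ := fun g p => inv g p.1 p.2) (by fun_prop)
    (genericProdEntries n)
  simp_rw [map_genericProdEntries] at hF
  have heval (M : Matrix (Fin n) (Fin n) ℂ) :
      evalMatrix F M = ∫ g, evalMatrix (prodEntries n) (inv g * M) ∂μ := by
    simp_rw [← evalMatrix_linSubst_kronecker]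
    exact hF (aeval fun p => M p.1 p.2).toLinearMap
  have hsmul (ζ : ℂ) (M : Matrix (Fin n) (Fin n) ℂ) :
      evalMatrix F (ζ • M) = (ζ ^ n) ^ n * evalMatrix F M := by
    simp_rw [heval, mul_smul_comm, evalMatrix_smul_prodEntries]
    exact integral_const_mul _ _
  have hinv (V : specialUnitaryGroup (Fin n) ℂ) (M : Matrix (Fin n) (Fin n) ℂ) :
      evalMatrix F (V * M) = evalMatrix F M := by
    rw [heval, heval, ← integral_mul_left_eq_self _ V]
    congr
    ext g
    congr 1
    rw [← mul_assoc]
    congr 1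
    change ((V * g)⁻¹ * V : specialUnitaryGroup (Fin n) ℂ).1 = (g⁻¹).1
    group
  have hFdet : F = C (evalMatrix F 1) * (mvPolynomialX (Fin n) (Fin n) ℂ).det ^ n := by
    refine eq_C_mul_det_pow fun U hU M => ?_
    obtain ⟨ζ, V, hV, rfl, hdet⟩ := exists_smul_mem_specialUnitaryGroup hn hU
    rw [smul_mul_assoc, hsmul, hdet, hinv ⟨V, hV⟩]
  have hone : evalMatrix F 1 = starRingEnd ℂ (∫ g : specialUnitaryGroup (Fin n) ℂ,
      ∏ i, ∏ j, (g : Matrix (Fin n) (Fin n) ℂ) i j ∂μ) := by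
    simp_rw [heval, mul_one, evalMatrix_prodEntries]
    exact integral_prod_inv_entries μ
  have hap := hF (apolar.flip ((mvPolynomialX (Fin n) (Fin n) ℂ).det ^ n))
  simp_rw [LinearMap.flip_apply] at hap
  have hdet (g : specialUnitaryGroup (Fin n) ℂ) : (inv g).det = 1 :=
    (mem_specialUnitaryGroup_iff.1 g⁻¹.2).2
  simp_rw [apolar_prodEntries_linSubst (hdet _)] at hap
  rw [integral_const, probReal_univ, one_smul, hFdet, ← smul_eq_C_mul, map_smul,
    LinearMap.smul_apply, smul_eq_mul, hone] at hap
  exact hap.symm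

end Averaging

open MeasureTheory in
/-- For n even, the Alon-Tarsi property for n holds iff the integral over SU(n), with respect
to the Haar probability measure, of the product of all matrix entries is nonzero. -/
theorem alonTarsi_iff_integral_prod_entries_ne_zero (n : ℕ) (hn : 0 < n) (hev : Even n)
    (μ : Measure (Matrix.specialUnitaryGroup (Fin n) ℂ))
    [IsProbabilityMeasure μ] [μ.IsMulLeftInvariant] :
    evenCard n ≠ oddCard n ↔
      ∫ g : Matrix.specialUnitaryGroup (Fin n) ℂ,
        (∏ i : Fin n, ∏ j : Fin n, (g : Matrix (Fin n) (Fin n) ℂ) i j) ∂μ ≠ 0 := by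
  have h := coeff_det_pow_eq_integral_mul hn.ne' μ
  rw [coeff_det_pow] at h
  rw [evenCard_ne_oddCard_iff, ← Int.cast_ne_zero (α := ℂ), h, mul_ne_zero_iff,
    and_iff_left apolar_det_pow_self_ne_zero, map_ne_zero]

end AlonTarsi
end

section
/- Let n be an even positive integer, let SU(n) be the special unitary group of n × n complex matrices with Haar probability measure μ, and for a matrix g let perm(g) = ∑_{σ ∈ Perm(Fin n)} ∏_i g_{i,σ(i)} be its permanent. Then the number of even Latin squares of size n differs from the number of odd Latin squares of size n (the Alon–Tarsi property for n) if and only if ∫_{g ∈ SU(n)} (perm g)^n dμ(g) ≠ 0. -/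
open scoped Classical

namespace AlonTarsi

/-- The permanent of an n × n complex matrix. -/
noncomputable def permanent {n : ℕ} (M : Matrix (Fin n) (Fin n) ℂ) : ℂ :=
  ∑ σ : Equiv.Perm (Fin n), ∏ i : Fin n, M i (σ i)

section

variable {n : ℕ}

lemma signFun_coe_s5 (σ : Equiv.Perm (Fin n)) : signFun (fun i => σ i) = Equiv.Perm.sign σ := by
  have h : Function.Bijective fun i => σ i := σ.bijective
  rw [signFun, dif_pos h]
  congr 2
  ext; rfl

/-- The permutation given by a row of a Latin square. -/
noncomputable def rowPerm (L : {L : Fin n → Fin n → Fin n // IsLatin L}) (k : Fin n) :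
    Equiv.Perm (Fin n) := Equiv.ofBijective _ (L.2.1 k)

/-- The permutation given by a column of a Latin square. -/
noncomputable def colPerm (L : {L : Fin n → Fin n → Fin n // IsLatin L}) (i : Fin n) :
    Equiv.Perm (Fin n) := Equiv.ofBijective _ (L.2.2 i)

lemma rowPerm_apply (L : {L : Fin n → Fin n → Fin n // IsLatin L}) (k i : Fin n) :
    rowPerm L k i = L.1 k i := rfl

lemma rowSign_eq (L : {L : Fin n → Fin n → Fin n // IsLatin L}) :
    rowSign L.1 = ((∏ k, Equiv.Perm.sign (rowPerm L k) : ℤˣ) : ℤ) := by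
  rw [rowSign, Units.coe_prod]
  exact Finset.prod_congr rfl fun k _ => signFun_coe_s5 (rowPerm L k)

lemma colSign_eq (L : {L : Fin n → Fin n → Fin n // IsLatin L}) :
    colSign L.1 = ((∏ i, Equiv.Perm.sign (colPerm L i) : ℤˣ) : ℤ) := by
  rw [colSign, Units.coe_prod]
  exact Finset.prod_congr rfl fun i _ => signFun_coe_s5 (colPerm L i)

/-- The conjugate of a Latin square: the cell in row `s` and column `r` holds the column in which
the symbol `s` occurs in row `r` of the original square. -/
noncomputable def conjugate (L : {L : Fin n → Fin n → Fin n // IsLatin L}) :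
    {L : Fin n → Fin n → Fin n // IsLatin L} :=
  ⟨fun s r => (rowPerm L r).symm s, fun s => by
    refine Finite.injective_iff_bijective.mp fun r r' h => ?_
    have h1 : L.1 r ((rowPerm L r).symm s) = s := (rowPerm L r).apply_symm_apply s
    have h2 : L.1 r' ((rowPerm L r').symm s) = s := (rowPerm L r').apply_symm_apply s
    dsimp only at h
    rw [← h] at h2
    exact (L.2.2 _).1 (h1.trans h2.symm), fun r => (rowPerm L r).symm.bijective⟩

lemma conjugate_apply (L : {L : Fin n → Fin n → Fin n // IsLatin L}) (s r : Fin n) :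
    (conjugate L).1 s r = (rowPerm L r).symm s := rfl

lemma conjugate_bijective :
    Function.Bijective (conjugate : {L : Fin n → Fin n → Fin n // IsLatin L} → _) := by
  refine Finite.injective_iff_bijective.mp fun L L' h => Subtype.ext ?_
  funext r c
  have : (rowPerm L r).symm = (rowPerm L' r).symm := by
    ext s
    rw [← conjugate_apply, h, conjugate_apply]
  rw [← rowPerm_apply, ← rowPerm_apply, Equiv.symm_bijective.1 this]

/-- The product of the row, column and symbol signs does not depend on the Latin square. -/
lemma rowSign_conjugate (L : {L : Fin n → Fin n → Fin n // IsLatin L}) :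
    rowSign (conjugate L).1 =
      (Equiv.Perm.sign (Equiv.prodComm (Fin n) (Fin n)) : ℤ) * sign L.1 := by
  have h : (Equiv.prodCongrLeft (rowPerm (conjugate L))) * Equiv.prodCongrRight (rowPerm L) =
      Equiv.prodComm (Fin n) (Fin n) * Equiv.prodCongrLeft (colPerm L) := by
    refine Equiv.ext fun ⟨r, c⟩ => Prod.ext ?_ rfl
    exact (rowPerm L r).symm_apply_apply c
  have h' := congrArg Equiv.Perm.sign h
  rw [map_mul, map_mul, Equiv.Perm.sign_prodCongrLeft, Equiv.Perm.sign_prodCongrRight,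
    Equiv.Perm.sign_prodCongrLeft] at h'
  rw [sign, rowSign_eq, rowSign_eq, colSign_eq, ← Units.val_mul, ← Units.val_mul,
    mul_left_comm, ← h', mul_left_comm, Int.units_mul_self, mul_one]

lemma sum_rowSign_eq :
    ∑ L : {L : Fin n → Fin n → Fin n // IsLatin L}, rowSign L.1 =
      (Equiv.Perm.sign (Equiv.prodComm (Fin n) (Fin n)) : ℤ) *
        ((evenCard n : ℤ) - oddCard n) := by
  rw [← conjugate_bijective.sum_comp, Finset.sum_congr rfl fun L _ => rowSign_conjugate L,
    ← Finset.mul_sum]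
  congr 1
  have hs (L : {L : Fin n → Fin n → Fin n // IsLatin L}) : sign L.1 = 1 ∨ sign L.1 = -1 := by
    rw [sign, rowSign_eq, colSign_eq, ← Units.val_mul]
    exact Int.isUnit_iff.mp (Units.isUnit _)
  have h (L : {L : Fin n → Fin n → Fin n // IsLatin L}) :
      sign L.1 = (if sign L.1 = 1 then 1 else 0) - (if sign L.1 = -1 then 1 else 0) := by
    rcases hs L with h | h <;> simp [h]
  rw [Finset.sum_congr rfl fun L _ => h L, Finset.sum_sub_distrib, evenCard, oddCard,
    Finset.natCast_card_filter, Finset.natCast_card_filter]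
  have hsum (f : (Fin n → Fin n → Fin n) → ℤ) :
      ∑ L : {L : Fin n → Fin n → Fin n // IsLatin L}, f L.1 =
        ∑ L, if IsLatin L then f L else 0 := by
    rw [← Finset.sum_filter]
    exact (Finset.sum_subtype _ (by simp) _).symm
  rw [hsum fun L => if sign L = 1 then 1 else 0, hsum fun L => if sign L = -1 then 1 else 0]
  congr 1 <;> exact Finset.sum_congr rfl fun L _ => by by_cases h : IsLatin L <;> simp [h]

lemma sum_rowSign_ne_zero_iff :
    ∑ L : {L : Fin n → Fin n → Fin n // IsLatin L}, rowSign L.1 ≠ 0 ↔ evenCard n ≠ oddCard n := by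
  rw [sum_rowSign_eq, mul_ne_zero_iff, sub_ne_zero]
  simp
end

section

open MvPolynomial Matrix

lemma eval_substitution_eq_zero {σ τ : Type*} (p : MvPolynomial σ ℂ) (q : σ → MvPolynomial τ ℂ)
    (s : Set ℂ) (hs : s.Infinite)
    (h : ∀ x : τ → ℂ, (∀ t, x t ∈ s) → eval (fun i => eval x (q i)) p = 0) (x : τ → ℂ) :
    eval (fun i => eval x (q i)) p = 0 := by
  have key : ∀ x : τ → ℂ, eval x (bind₁ q p) = eval (fun i => eval x (q i)) p := fun x => by
    simpa [aeval_eq_eval, coe_aeval_eq_eval] using aeval_bind₁ (R := ℂ) x q p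
  have h0 : bind₁ q p = 0 := funext_set (fun _ => s) (fun _ => hs) fun x hx => by
    rw [key, h x fun t => hx t trivial, map_zero]
  rw [← key, h0, map_zero]

lemma infinite_unit_circle : {z : ℂ | ‖z‖ = 1}.Infinite := by
  have : (Metric.sphere (0 : ℂ) 1).Infinite := by
    have h : Infinite Circle := Circle.argEquiv.infinite_iff.mpr
      (Set.infinite_coe_iff.mpr (Set.Ioc_infinite (by linarith [Real.pi_pos])))
    exact Set.infinite_coe_iff.mp (h : Infinite (Metric.sphere (0 : ℂ) 1))
  convert this using 1
  ext z; simp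

lemma infinite_range_ofReal : (Set.range ((↑) : ℝ → ℂ)).Infinite :=
  Set.infinite_range_of_injective Complex.ofReal_injective

variable {m : Type*} [Fintype m] [DecidableEq m]

/-- A polynomial in the matrix entries that vanishes on the unitary group vanishes on Hermitian
matrices. -/
lemma eval_eq_zero_of_isHermitian (p : MvPolynomial (m × m) ℂ)
    (h : ∀ U ∈ unitaryGroup m ℂ, eval (fun q => U q.1 q.2) p = 0)
    (H : Matrix m m ℂ) (hH : H.IsHermitian) : eval (fun q => H q.1 q.2) p = 0 := by
  set V : unitaryGroup m ℂ := hH.eigenvectorUnitary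
  have key := eval_substitution_eq_zero p
    (fun q : m × m => ∑ k, C ((V : Matrix m m ℂ) q.1 k) * X k * C (star (V : Matrix m m ℂ) k q.2))
    _ infinite_unit_circle
  have hev : ∀ x : m → ℂ, (fun q : m × m => eval x (∑ k, C ((V : Matrix m m ℂ) q.1 k) * X k *
      C (star (V : Matrix m m ℂ) k q.2))) =
      fun q => ((V : Matrix m m ℂ) * diagonal x * star (V : Matrix m m ℂ)) q.1 q.2 := by
    intro x
    funext q
    rw [mul_apply]
    simp [mul_diagonal]
  simp only [hev] at key
  have hspec := hH.spectral_theorem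
  rw [Unitary.conjStarAlgAut_apply] at hspec
  rw [hspec]
  refine key (fun x hx => h _ ?_) _
  refine mul_mem (mul_mem V.2 ?_) (Unitary.star_mem V.2)
  rw [mem_unitaryGroup_iff, star_eq_conjTranspose, diagonal_conjTranspose, diagonal_mul_diagonal,
    ← diagonal_one]
  congr 1
  funext i
  have : ‖x i‖ = 1 := hx i
  simp [Complex.mul_conj, Complex.normSq_eq_norm_sq, this]

/-- The unitary group is Zariski dense in the space of complex matrices. -/
lemma eq_zero_of_eval_unitary_eq_zero (p : MvPolynomial (m × m) ℂ)
    (h : ∀ U ∈ unitaryGroup m ℂ, eval (fun q => U q.1 q.2) p = 0) : p = 0 := by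
  have key := eval_substitution_eq_zero p
    (fun q : m × m => (X (Sum.inl q) + X (Sum.inl q.swap) +
      C Complex.I * (X (Sum.inr q) - X (Sum.inr q.swap)) : MvPolynomial ((m × m) ⊕ (m × m)) ℂ))
    _ infinite_range_ofReal fun x hx => by
      have hr : ∀ t, (starRingEnd ℂ) (x t) = x t := fun t => by
        obtain ⟨r, hr⟩ := hx t
        rw [← hr, Complex.conj_ofReal]
      simp only [map_add, map_mul, map_sub, eval_X, eval_C]
      refine eval_eq_zero_of_isHermitian p h (of fun i j => x (.inl (i, j)) + x (.inl (j, i)) +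
        Complex.I * (x (.inr (i, j)) - x (.inr (j, i)))) ?_
      ext i j
      simp [hr, conjTranspose_apply]
      ring
  refine MvPolynomial.funext fun y => ?_
  rw [map_zero, ← key (Sum.elim (fun q => y q / 2) fun q => -Complex.I * y q / 2)]
  congr 2
  funext q
  simp
  linear_combination ((y q - y q.swap) / 2) * Complex.I_mul_I

end

section

open MvPolynomial Matrix MeasureTheory

variable {n : ℕ}

/-- The mixed moment of the matrix entries at the positions `(α p, β p)`. -/
noncomputable def moment (μ : Measure (specialUnitaryGroup (Fin n) ℂ))
    (α β : Fin n × Fin n → Fin n) : ℂ :=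
  ∫ g : specialUnitaryGroup (Fin n) ℂ, ∏ p, (g : Matrix (Fin n) (Fin n) ℂ) (α p) (β p) ∂μ

lemma integrable_prod_entries (μ : Measure (specialUnitaryGroup (Fin n) ℂ)) [IsFiniteMeasure μ]
    (α β : Fin n × Fin n → Fin n) :
    Integrable (fun g : specialUnitaryGroup (Fin n) ℂ =>
      ∏ p, (g : Matrix (Fin n) (Fin n) ℂ) (α p) (β p)) μ := by
  have hc : Continuous fun g : specialUnitaryGroup (Fin n) ℂ =>
      ∏ p, (g : Matrix (Fin n) (Fin n) ℂ) (α p) (β p) :=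
    continuous_finsetProd _ fun p _ => continuous_subtype_val.matrix_elem _ _
  refine Integrable.of_bound hc.aestronglyMeasurable 1 (Filter.Eventually.of_forall fun g => ?_)
  rw [norm_prod]
  exact Finset.prod_le_one (fun _ _ => norm_nonneg _) fun p _ =>
    entry_norm_bound_of_unitary (specialUnitaryGroup_le_unitaryGroup g.2) _ _

lemma exists_smul_specialUnitary (hn : 0 < n) {U : Matrix (Fin n) (Fin n) ℂ}
    (hU : U ∈ unitaryGroup (Fin n) ℂ) :
    ∃ (z : ℂ) (h : specialUnitaryGroup (Fin n) ℂ), z ^ n = U.det ∧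
      U = z • (h : Matrix (Fin n) (Fin n) ℂ) := by
  obtain ⟨z, hz⟩ := IsAlgClosed.exists_pow_nat_eq U.det hn
  have hdet : ‖U.det‖ = 1 := CStarRing.norm_of_mem_unitary (det_of_mem_unitary hU)
  have hz1 : ‖z‖ = 1 := by
    rw [← hz, norm_pow] at hdet
    exact (pow_eq_one_iff_of_nonneg (norm_nonneg z) hn.ne').mp hdet
  have hz0 : z ≠ 0 := by
    rintro rfl
    simp at hz1
  refine ⟨z, ⟨z⁻¹ • U, mem_specialUnitaryGroup_iff.mpr ⟨?_, ?_⟩⟩, hz, ?_⟩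
  · rw [mem_unitaryGroup_iff, star_smul, smul_mul_smul_comm, mem_unitaryGroup_iff.mp hU]
    have : z⁻¹ * star z⁻¹ = 1 := by
      rw [Complex.star_def, Complex.mul_conj, Complex.normSq_eq_norm_sq]
      simp [hz1]
    rw [this, one_smul]
  · rw [det_smul, Fintype.card_fin, inv_pow, hz, inv_mul_cancel₀]
    rw [← hz]
    exact pow_ne_zero _ hz0
  · simp [smul_smul, hz0]

/-- Integrating a monomial of degree `n ^ 2` over the translates of a generic matrix by the special
unitary group gives a multiple of the `n`-th power of the determinant. -/
lemma sum_moment_mul_prod_X (hn : 0 < n) (μ : Measure (specialUnitaryGroup (Fin n) ℂ))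
    [IsProbabilityMeasure μ] [μ.IsMulLeftInvariant] (α β : Fin n × Fin n → Fin n) :
    ∑ φ : Fin n × Fin n → Fin n, C (moment μ φ β) * ∏ p, X (α p, φ p) =
      C (moment μ α β) * (mvPolynomialX (Fin n) (Fin n) ℂ).det ^ n := by
  rw [← sub_eq_zero]
  refine eq_zero_of_eval_unitary_eq_zero _ fun U hU => ?_
  have hexp : ∑ φ : Fin n × Fin n → Fin n, moment μ φ β * ∏ p, U (α p) (φ p) =
      ∫ g : specialUnitaryGroup (Fin n) ℂ,
        ∏ p, (U * (g : Matrix (Fin n) (Fin n) ℂ)) (α p) (β p) ∂μ := by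
    simp_rw [mul_apply, Finset.prod_univ_sum, Fintype.piFinset_univ, Finset.prod_mul_distrib]
    rw [integral_finsetSum _ fun φ _ => (integrable_prod_entries μ φ β).const_mul _]
    refine Finset.sum_congr rfl fun φ _ => ?_
    rw [integral_const_mul, mul_comm, moment]
  obtain ⟨z, h, hz, rfl⟩ := exists_smul_specialUnitary hn hU
  have hinv := integral_mul_left_eq_self (μ := μ) (fun g : specialUnitaryGroup (Fin n) ℂ =>
    ∏ p, (g : Matrix (Fin n) (Fin n) ℂ) (α p) (β p)) h
  simp only [map_sub, map_sum, map_mul, map_prod, eval_X, eval_C, map_pow,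
    eval_det_mvPolynomialX]
  rw [hexp, sub_eq_zero]
  simp_rw [smul_mul, Matrix.smul_apply, smul_eq_mul, Finset.prod_mul_distrib, Finset.prod_const]
  rw [integral_const_mul]
  simp only [Submonoid.coe_mul] at hinv
  rw [hinv, mul_comm, ← moment]
  congr 1
  change _ = (Matrix.det (z • (h : Matrix (Fin n) (Fin n) ℂ))) ^ n
  rw [← hz]
  simp [← pow_mul]

end

section

open MvPolynomial Matrix MeasureTheory

lemma prod_X_eq_monomial {ι σ : Type*} [Fintype ι] (α : ι → σ) :
    (∏ p, X (α p) : MvPolynomial σ ℂ) = monomial (∑ p, Finsupp.single (α p) 1) 1 := by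
  rw [monomial_sum_one]
  rfl

lemma sum_single_eq_iff_bijective {ι : Type*} [Fintype ι] (α : ι → ι) :
    ∑ p, Finsupp.single (α p) 1 = (∑ p, Finsupp.single p 1 : ι →₀ ℕ) ↔ Function.Bijective α := by
  refine ⟨fun h => Finite.surjective_iff_bijective.mp fun q => ?_,
    fun h => h.sum_comp fun p => Finsupp.single p 1⟩
  by_contra! hq
  have := DFunLike.congr_fun h q
  simp [Finsupp.single_apply, hq] at this

lemma coeff_ones_prod_X {ι : Type*} [Fintype ι] (α : ι → ι)
    [Decidable (Function.Bijective α)] :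
    coeff (∑ p, Finsupp.single p 1) (∏ p, X (α p) : MvPolynomial ι ℂ) =
      if Function.Bijective α then 1 else 0 := by
  rw [prod_X_eq_monomial, coeff_monomial]
  simp only [sum_single_eq_iff_bijective]

variable {n : ℕ}

lemma sum_perm_eq {M : Type*} [AddCommMonoid M] (F : (Fin n → Fin n) → M) :
    ∑ σ : Equiv.Perm (Fin n), F σ = ∑ f, if Function.Bijective f then F f else 0 := by
  rw [← Finset.sum_filter]
  refine Finset.sum_bij (fun σ _ => σ)
    (fun σ _ => (Finset.mem_filter_univ _).mpr σ.bijective)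
    (fun _ _ _ _ h => DFunLike.coe_injective h) (fun f hf => ?_) fun _ _ => rfl
  exact ⟨Equiv.ofBijective f ((Finset.mem_filter_univ _).mp hf), Finset.mem_univ _, rfl⟩

lemma bijective_fst_prod_iff (f : Fin n → Fin n → Fin n) :
    (Function.Bijective fun p : Fin n × Fin n => (p.1, f p.1 p.2)) ↔
      ∀ k, Function.Bijective (f k) := by
  constructor
  · refine fun h k => Finite.injective_iff_bijective.mp fun i j hij => ?_
    have : (k, i) = (k, j) := h.1 (Prod.ext rfl hij)
    exact congrArg Prod.snd this
  · refine fun h => Finite.injective_iff_bijective.mp fun ⟨k, i⟩ ⟨l, j⟩ hij => ?_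
    obtain ⟨rfl, hij⟩ := Prod.ext_iff.mp hij
    exact Prod.ext rfl ((h _).1 hij)

lemma permanent_pow (M : Matrix (Fin n) (Fin n) ℂ) :
    AlonTarsi.permanent M ^ n = ∑ φ : Fin n × Fin n → Fin n,
      if Function.Bijective fun p : Fin n × Fin n => (p.1, φ p) then ∏ p, M (φ p) p.2 else 0 := by
  have hp : AlonTarsi.permanent M =
      ∑ f : Fin n → Fin n, if Function.Bijective f then ∏ i, M (f i) i else 0 := by
    rw [← sum_perm_eq]
    exact (Matrix.permanent_transpose Mᵀ).symm.trans rfl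
  have hpow : AlonTarsi.permanent M ^ n = ∏ _k : Fin n, AlonTarsi.permanent M := by simp
  rw [hpow, hp, Finset.prod_univ_sum, Fintype.piFinset_univ]
  refine Fintype.sum_equiv (Equiv.curry _ _ _).symm _ _ fun f => ?_
  have := bijective_fst_prod_iff f
  simp only [Equiv.curry_symm_apply, Function.uncurry]
  rw [if_congr this rfl rfl, Fintype.prod_prod_type]
  split_ifs with h
  · exact Finset.prod_congr rfl fun k _ => if_pos (h k)
  · obtain ⟨k, hk⟩ := not_forall.mp h
    exact Finset.prod_eq_zero (Finset.mem_univ k) (if_neg hk)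

lemma det_pow {R : Type*} [CommRing R] (A : Matrix (Fin n) (Fin n) R) :
    A.det ^ n = ∑ s : Fin n → Equiv.Perm (Fin n),
      ((∏ k, (Equiv.Perm.sign (s k) : ℤ) : ℤ) : R) * ∏ p : Fin n × Fin n, A (s p.1 p.2) p.2 := by
  have hpow : A.det ^ n = ∏ _k : Fin n, A.det := by simp
  rw [hpow, det_apply', Finset.prod_univ_sum, Fintype.piFinset_univ]
  refine Finset.sum_congr rfl fun s _ => ?_
  rw [Finset.prod_mul_distrib, Fintype.prod_prod_type]
  push_cast
  rfl

lemma coeff_ones_det_pow :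
    coeff (∑ p, Finsupp.single p 1) ((mvPolynomialX (Fin n) (Fin n) ℂ).det ^ n) =
      ((∑ L : {L : Fin n → Fin n → Fin n // IsLatin L}, rowSign L.1 : ℤ) : ℂ) := by
  rw [det_pow, coeff_sum]
  have h (s : Fin n → Equiv.Perm (Fin n)) : coeff (∑ p, Finsupp.single p 1)
      (((∏ k, (Equiv.Perm.sign (s k) : ℤ) : ℤ) : MvPolynomial (Fin n × Fin n) ℂ) *
        ∏ p : Fin n × Fin n, mvPolynomialX (Fin n) (Fin n) ℂ (s p.1 p.2) p.2) =
      if Function.Bijective fun p : Fin n × Fin n => (s p.1 p.2, p.2) then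
        ((∏ k, (Equiv.Perm.sign (s k) : ℤ) : ℤ) : ℂ) else 0 := by
    simp only [mvPolynomialX_apply]
    rw [← map_intCast (C : ℂ →+* MvPolynomial (Fin n × Fin n) ℂ), coeff_C_mul,
      coeff_ones_prod_X fun p : Fin n × Fin n => (s p.1 p.2, p.2), mul_ite, mul_one, mul_zero]
  rw [Finset.sum_congr rfl fun s _ => h s, ← Finset.sum_filter, Int.cast_sum]
  symm
  refine Finset.sum_bij (fun L _ => rowPerm L) (fun L _ => ?_) (fun L _ L' _ h => ?_)
    (fun s hs => ?_) fun L _ => ?_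
  · rw [Finset.mem_filter_univ]
    refine Finite.injective_iff_bijective.mp fun ⟨k, i⟩ ⟨l, j⟩ hij => ?_
    obtain ⟨h1, h2⟩ := Prod.ext_iff.mp hij
    obtain rfl : i = j := h2
    exact Prod.ext ((L.2.2 i).1 h1) rfl
  · refine Subtype.ext (funext fun k => funext fun i => ?_)
    rw [← rowPerm_apply, h, rowPerm_apply]
  · rw [Finset.mem_filter_univ] at hs
    refine ⟨⟨fun k i => s k i, fun k => (s k).bijective, fun i =>
      Finite.injective_iff_bijective.mp fun k l h => ?_⟩, Finset.mem_univ _,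
      funext fun k => Equiv.ext fun i => rfl⟩
    have : (k, i) = (l, i) := hs.1 (Prod.ext h rfl)
    exact congrArg Prod.fst this
  · rw [rowSign_eq, Units.coe_prod]

end

section

open MvPolynomial Matrix MeasureTheory

variable {n : ℕ} (μ : Measure (specialUnitaryGroup (Fin n) ℂ))

lemma moment_fst_congr {φ ψ : Fin n × Fin n → Fin n}
    (h : ∑ p : Fin n × Fin n, Finsupp.single (p.1, φ p) 1 =
      (∑ p : Fin n × Fin n, Finsupp.single (p.1, ψ p) 1 : Fin n × Fin n →₀ ℕ)) :
    moment μ φ Prod.fst = moment μ ψ Prod.fst := by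
  have hX : (∏ p : Fin n × Fin n, X (p.1, φ p) : MvPolynomial (Fin n × Fin n) ℂ) =
      ∏ p : Fin n × Fin n, X (p.1, ψ p) := by
    rw [prod_X_eq_monomial fun p : Fin n × Fin n => (p.1, φ p), h,
      prod_X_eq_monomial fun p : Fin n × Fin n => (p.1, ψ p)]
  refine integral_congr_ae (Filter.Eventually.of_forall fun g => ?_)
  simpa using congrArg (eval fun q => (g : Matrix (Fin n) (Fin n) ℂ) q.2 q.1) hX

lemma moment_swap (α β : Fin n × Fin n → Fin n) :
    moment μ (α ∘ Prod.swap) (β ∘ Prod.swap) = moment μ α β := by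
  simp only [moment, Function.comp_apply]
  congr 1
  funext g
  exact (Equiv.prodComm (Fin n) (Fin n)).prod_comp
    fun p => (g : Matrix (Fin n) (Fin n) ℂ) (α p) (β p)

variable [IsProbabilityMeasure μ] [μ.IsMulLeftInvariant]

/-- Comparison of coefficients in the averaged `n`-th powers of linear forms. -/
lemma exists_mul_moment_fst (hn : 0 < n) (ψ : Fin n × Fin n → Fin n) :
    ∃ N : ℕ, N ≠ 0 ∧ N * moment μ ψ Prod.fst = moment μ Prod.fst Prod.fst *
      coeff (∑ p : Fin n × Fin n, Finsupp.single (p.1, ψ p) 1)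
        ((mvPolynomialX (Fin n) (Fin n) ℂ).det ^ n) := by
  refine ⟨(Finset.univ.filter fun φ : Fin n × Fin n → Fin n =>
    ∑ p : Fin n × Fin n, Finsupp.single (p.1, φ p) 1 =
      (∑ p : Fin n × Fin n, Finsupp.single (p.1, ψ p) 1 : Fin n × Fin n →₀ ℕ)).card,
    Finset.card_ne_zero_of_mem (a := ψ) (by simp), ?_⟩
  rw [← coeff_C_mul, ← sum_moment_mul_prod_X hn, coeff_sum, Finset.natCast_card_filter,
    Finset.sum_mul]
  refine Finset.sum_congr rfl fun φ _ => ?_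
  rw [coeff_C_mul, prod_X_eq_monomial fun p : Fin n × Fin n => (p.1, φ p), coeff_monomial]
  split_ifs with h
  · rw [moment_fst_congr μ h, mul_comm]
  · rw [zero_mul, mul_zero]

lemma moment_fst_fst_ne_zero (hn : 0 < n) : moment μ Prod.fst Prod.fst ≠ 0 := by
  intro h0
  have hzero (ψ : Fin n × Fin n → Fin n) : moment μ ψ Prod.fst = 0 := by
    obtain ⟨N, hN, h⟩ := exists_mul_moment_fst μ hn ψ
    rw [h0, zero_mul] at h
    exact (mul_eq_zero.mp h).resolve_left (Nat.cast_ne_zero.mpr hN)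
  have h1 : ∫ g : specialUnitaryGroup (Fin n) ℂ,
      (g : Matrix (Fin n) (Fin n) ℂ).det ^ n ∂μ = 1 := by
    simp [(mem_specialUnitaryGroup_iff.mp (Subtype.prop _)).2]
  refine one_ne_zero (h1.symm.trans ?_)
  simp_rw [det_pow]
  rw [integral_finsetSum _ fun s _ =>
    (integrable_prod_entries μ (fun p => s p.1 p.2) Prod.snd).const_mul _]
  refine Finset.sum_eq_zero fun s _ => ?_
  rw [integral_const_mul]
  have hs : moment μ (fun p => s p.1 p.2) Prod.snd = 0 :=
    (moment_swap μ (fun p => s p.1 p.2) Prod.snd).symm.trans (hzero _)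
  rw [← moment, hs, mul_zero]

lemma integral_permanent_pow (hn : 0 < n) :
    ∫ g : specialUnitaryGroup (Fin n) ℂ,
      AlonTarsi.permanent (g : Matrix (Fin n) (Fin n) ℂ) ^ n ∂μ = moment μ Prod.fst Prod.snd *
        coeff (∑ p, Finsupp.single p 1) ((mvPolynomialX (Fin n) (Fin n) ℂ).det ^ n) := by
  rw [← coeff_C_mul, ← sum_moment_mul_prod_X hn, coeff_sum]
  simp_rw [permanent_pow]
  rw [integral_finsetSum]
  · refine Finset.sum_congr rfl fun φ _ => ?_
    rw [coeff_C_mul, coeff_ones_prod_X fun p : Fin n × Fin n => (p.1, φ p)]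
    split_ifs with h
    · rw [mul_one, moment]
    · rw [integral_zero, mul_zero]
  · intro φ _
    split_ifs with h
    · exact integrable_prod_entries μ φ Prod.snd
    · exact integrable_zero _ _ _

end

open MeasureTheory in
/-- For n even, the Alon-Tarsi property for n holds iff the integral over SU(n), with respect
to the Haar probability measure, of the n-th power of the permanent is nonzero. -/
theorem alonTarsi_iff_integral_permanent_pow_ne_zero (n : ℕ) (hn : 0 < n) (hev : Even n)
    (μ : Measure (Matrix.specialUnitaryGroup (Fin n) ℂ))
    [IsProbabilityMeasure μ] [μ.IsMulLeftInvariant] :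
    evenCard n ≠ oddCard n ↔
      ∫ g : Matrix.specialUnitaryGroup (Fin n) ℂ,
        (permanent (g : Matrix (Fin n) (Fin n) ℂ)) ^ n ∂μ ≠ 0 := by
  have ha := coeff_ones_det_pow (n := n)
  obtain ⟨N, -, h⟩ := exists_mul_moment_fst μ hn Prod.snd
  rw [show moment μ Prod.snd Prod.fst = moment μ Prod.fst Prod.snd from
    moment_swap μ Prod.fst Prod.snd] at h
  have hm := moment_fst_fst_ne_zero μ hn
  rw [integral_permanent_pow μ hn, ← sum_rowSign_ne_zero_iff, ← Int.cast_ne_zero (α := ℂ), ← ha]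
  refine ⟨fun h0 => mul_ne_zero (fun h1 => ?_) h0, right_ne_zero_of_mul⟩
  rw [h1, mul_zero] at h
  exact mul_ne_zero hm h0 h.symm

end AlonTarsi
end
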